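/- (Theorem 4) For u, v ∈ Γ, the pair (u,v) is a covering pair of the poset (Γ, ≼_US) (that is, u ≺_US v and every w ∈ Γ with u ≼_US w ≼_US v satisfies w ∈ {u,v}) if and only if either (US1) there exists s ∈ [1,n] with u_s ≤ m−1, v = Up(u,s), and u_j ∉ {u_s, u_s+1} for all j ∈ [s+1,n], or (US2) there exist s < t in [1,n] with u_s < u_t, v = Swap(u,s,t), and u_j ∉ [u_s, u_t] for all j ∈ [s+1,t−1]. -/

import Mathlib

open Finset

/-- `Up u s` increases the `s`-th entry of the PV sequence `u` by one. -/
def Up {n : ℕ} (u : Fin n → ℕ) (s : Fin n) : Fin n → ℕ :=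
  fun j => if j = s then u s + 1 else u j

/-- `Move u s t` moves one pageview from period `t` to the more recent period `s`. -/
def Move {n : ℕ} (u : Fin n → ℕ) (s t : Fin n) : Fin n → ℕ :=
  fun j => if j = s then u s + 1 else if j = t then u t - 1 else u j

/-- `Swap u s t` exchanges the entries of `u` at positions `s` and `t`. -/
def Swap {n : ℕ} (u : Fin n → ℕ) (s t : Fin n) : Fin n → ℕ :=
  fun j => if j = s then u t else if j = t then u s else u j

/-- Membership in `Γ = {0,1,...,m}^n`. -/
def InGamma {n : ℕ} (m : ℕ) (u : Fin n → ℕ) : Prop := ∀ j, u j ≤ m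

/-- Strict lexicographic order: `u ≺_lex v` iff there is `s` with `u s < v s`
and `u j = v j` for all `j < s`. -/
def LexLt {n : ℕ} (u v : Fin n → ℕ) : Prop :=
  ∃ s : Fin n, u s < v s ∧ ∀ j : Fin n, j < s → u j = v j

/-- `u ≼_lex v` iff `u ≺_lex v` or `u = v`. -/
def LexLe {n : ℕ} (u v : Fin n → ℕ) : Prop := LexLt u v ∨ u = v

/-- One step of the `Up`/`Move` relation. -/
def UMStep {n : ℕ} (m : ℕ) (u v : Fin n → ℕ) : Prop :=
  (∃ s : Fin n, u s ≤ m - 1 ∧ v = Up u s) ∨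
  (∃ s t : Fin n, s < t ∧ u s ≤ m - 1 ∧ 1 ≤ u t ∧ v = Move u s t)

/-- `u ≺_UM v`: transitive closure of the `Up`/`Move` steps. -/
def UMLt {n : ℕ} (m : ℕ) : (Fin n → ℕ) → (Fin n → ℕ) → Prop :=
  Relation.TransGen (UMStep m)

/-- `u ≼_UM v` iff `u ≺_UM v` or `u = v`. -/
def UMLe {n : ℕ} (m : ℕ) (u v : Fin n → ℕ) : Prop := UMLt m u v ∨ u = v

/-- One step of the `Up`/`Swap` relation. -/
def USStep {n : ℕ} (m : ℕ) (u v : Fin n → ℕ) : Prop :=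
  (∃ s : Fin n, u s ≤ m - 1 ∧ v = Up u s) ∨
  (∃ s t : Fin n, s < t ∧ u s < u t ∧ v = Swap u s t)

/-- `u ≺_US v`: transitive closure of the `Up`/`Swap` steps. -/
def USLt {n : ℕ} (m : ℕ) : (Fin n → ℕ) → (Fin n → ℕ) → Prop :=
  Relation.TransGen (USStep m)

/-- `u ≼_US v` iff `u ≺_US v` or `u = v`. -/
def USLe {n : ℕ} (m : ℕ) (u v : Fin n → ℕ) : Prop := USLt m u v ∨ u = v

/-- The number of positions `j < k` at which the entry of `u` is at least `c`. -/
def prefixCount {n : ℕ} (u : Fin n → ℕ) (c : ℕ) : ℕ → ℕ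
  | 0 => 0
  | k + 1 => prefixCount u c k + if h : k < n then (if c ≤ u ⟨k, h⟩ then 1 else 0) else 0

theorem prefixCount_succ {n : ℕ} (u : Fin n → ℕ) (c : ℕ) (j : Fin n) :
    prefixCount u c (j + 1) = prefixCount u c j + if c ≤ u j then 1 else 0 := by
  simp [prefixCount]

theorem prefixCount_up {n : ℕ} (u : Fin n → ℕ) (s : Fin n) (c k : ℕ) :
    prefixCount (Up u s) c k =
      prefixCount u c k + if s.val < k ∧ c = u s + 1 then 1 else 0 := by
  induction k with
  | zero => simp [prefixCount]
  | succ k ih =>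
    rw [prefixCount, prefixCount, ih]
    by_cases h : k < n
    · by_cases hs : (⟨k, h⟩ : Fin n) = s
      · subst hs
        simp only [Up]
        grind
      · have : s.val ≠ k := fun e => hs (Fin.ext e.symm)
        simp only [Up, hs]
        grind
    · grind

theorem prefixCount_swap {n : ℕ} (u : Fin n → ℕ) {s t : Fin n} (hst : s < t)
    (hu : u s < u t) (c k : ℕ) :
    prefixCount (Swap u s t) c k =
      prefixCount u c k + if s.val < k ∧ k ≤ t.val ∧ u s < c ∧ c ≤ u t then 1 else 0 := by
  have hst' : s.val < t.val := hst
  induction k with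
  | zero => simp [prefixCount]
  | succ k ih =>
    rw [prefixCount, prefixCount, ih]
    by_cases h : k < n
    · by_cases hs : (⟨k, h⟩ : Fin n) = s
      · subst hs
        simp only [Swap]
        grind
      · have hsk : s.val ≠ k := fun e => hs (Fin.ext e.symm)
        by_cases ht : (⟨k, h⟩ : Fin n) = t
        · subst ht
          simp only [Swap]
          grind
        · have htk : t.val ≠ k := fun e => ht (Fin.ext e.symm)
          simp only [Swap, hs, ht]
          grind
    · grind

theorem USStep.prefixCount_le {n m : ℕ} {u v : Fin n → ℕ} (h : USStep m u v) (c k : ℕ) :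
    prefixCount u c k ≤ prefixCount v c k := by
  rcases h with ⟨s, -, rfl⟩ | ⟨s, t, hst, hu, rfl⟩
  · rw [prefixCount_up]
    exact Nat.le_add_right _ _
  · rw [prefixCount_swap u hst hu]
    exact Nat.le_add_right _ _

theorem USLe.prefixCount_le {n m : ℕ} {u v : Fin n → ℕ} (h : USLe m u v) (c k : ℕ) :
    prefixCount u c k ≤ prefixCount v c k := by
  rcases h with h | rfl
  · induction h with
    | single h => exact h.prefixCount_le c k
    | tail _ h ih => exact ih.trans (h.prefixCount_le c k)
  · exact le_rfl

theorem USStep.inGamma {n m : ℕ} (hm : 0 < m) {u v : Fin n → ℕ} (h : USStep m u v)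
    (hu : InGamma m u) : InGamma m v := by
  intro j
  have hj := hu j
  rcases h with ⟨s, hs, rfl⟩ | ⟨s, t, -, -, rfl⟩
  · simp only [Up]
    split_ifs <;> omega
  · have h₁ := hu s
    have h₂ := hu t
    simp only [Swap]
    split_ifs <;> omega

theorem USStep.ne {n m : ℕ} {u v : Fin n → ℕ} (h : USStep m u v) : v ≠ u := by
  rintro rfl
  rcases h with ⟨s, -, h⟩ | ⟨s, t, -, hu, h⟩
  · have := congrFun h s
    simp [Up] at this
  · have := congrFun h s
    simp only [Swap, if_true] at this
    omega

theorem eq_or_eq_of_between_up {n m : ℕ} {u w : Fin n → ℕ} {s : Fin n}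
    (hj : ∀ j : Fin n, s < j → u j ≠ u s ∧ u j ≠ u s + 1)
    (huw : USLe m u w) (hwv : USLe m w (Up u s)) : w = u ∨ w = Up u s := by
  have hle := huw.prefixCount_le
  have hge := hwv.prefixCount_le
  simp only [prefixCount_up] at hge
  have hagree : ∀ (j : Fin n) (c : ℕ), j < s ∨ c ≠ u s + 1 → (c ≤ w j ↔ c ≤ u j) := by
    intro j c hc
    rw [Fin.lt_def] at hc
    have h₁ := prefixCount_succ u c j
    have h₂ := prefixCount_succ w c j
    have h₃ := hle c j
    have h₄ := hge c j
    have h₅ := hle c (j + 1)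
    have h₆ := hge c (j + 1)
    grind
  have hne : ∀ j, j ≠ s → w j = u j := by
    intro j hjs
    rcases lt_or_gt_of_ne hjs with h | h
    · have h₁ := hagree j (w j) (Or.inl h)
      have h₂ := hagree j (u j) (Or.inl h)
      omega
    · have h₀ := hj j h
      have h₁ := hagree j (w j)
      have h₂ := hagree j (u j)
      have h₃ := hagree j (u s)
      have h₄ := hagree j (u s + 2)
      grind
  have hs : w s = u s ∨ w s = u s + 1 := by
    have h₃ := hagree s (u s)
    have h₄ := hagree s (u s + 2)
    grind
  refine hs.imp (fun h => ?_) (fun h => ?_) <;> funext j <;> by_cases hjs : j = s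
  · rw [hjs, h]
  · exact hne j hjs
  · simp [Up, hjs, h]
  · simp [Up, hjs, hne j hjs]

theorem eq_or_eq_of_between_swap {n m : ℕ} {u w : Fin n → ℕ} {s t : Fin n}
    (hst : s < t) (hu : u s < u t)
    (hj : ∀ j : Fin n, s < j → j < t → ¬(u s ≤ u j ∧ u j ≤ u t))
    (huw : USLe m u w) (hwv : USLe m w (Swap u s t)) : w = u ∨ w = Swap u s t := by
  have hle := huw.prefixCount_le
  have hge := hwv.prefixCount_le
  simp only [prefixCount_swap u hst hu] at hge
  have hst' : s.val < t.val := hst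
  have hagree : ∀ (j : Fin n) (c : ℕ), j < s ∨ t < j ∨ c ≤ u s ∨ u t < c →
      (c ≤ w j ↔ c ≤ u j) := by
    intro j c hc
    rw [Fin.lt_def, Fin.lt_def] at hc
    have h₁ := prefixCount_succ u c j
    have h₂ := prefixCount_succ w c j
    have h₃ := hle c j
    have h₄ := hge c j
    have h₅ := hle c (j + 1)
    have h₆ := hge c (j + 1)
    grind
  have hne : ∀ j, j ≠ s → j ≠ t → w j = u j := by
    intro j hjs hjt
    have h₁ := hagree j (w j)
    have h₂ := hagree j (u j)
    have h₃ := hagree j (u s)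
    have h₄ := hagree j (u t + 1)
    have h₀ := hj j
    grind
  have hmid : ∀ (c k : ℕ), s.val < k → k ≤ t.val → prefixCount w c k + (if c ≤ u s then 1 else 0)
      = prefixCount u c k + if c ≤ w s then 1 else 0 := by
    intro c k hsk
    induction k, hsk using Nat.le_induction with
    | base =>
      intro _
      have h₁ := prefixCount_succ u c s
      have h₂ := prefixCount_succ w c s
      have h₃ := hle c s
      have h₄ := hge c s
      grind
    | succ k hsk ih =>
      intro hk
      have hkn : k < n := by omega
      have e := hne ⟨k, hkn⟩ (by grind) (by grind)
      have h₁ := prefixCount_succ u c ⟨k, hkn⟩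
      have h₂ := prefixCount_succ w c ⟨k, hkn⟩
      rw [e] at h₂
      have := ih (by omega)
      simp only at h₁ h₂
      omega
  have htwo : ∀ c, (if c ≤ w s then 1 else 0) + (if c ≤ w t then 1 else 0)
      = (if c ≤ u s then 1 else 0) + (if c ≤ u t then 1 else 0) := by
    intro c
    have h₁ := prefixCount_succ u c t
    have h₂ := prefixCount_succ w c t
    have h₃ := hle c (t + 1)
    have h₄ := hge c (t + 1)
    have h₅ := hmid c t hst' le_rfl
    have h₆ : ¬ (t.val + 1 ≤ t.val) := by omega
    simp only [h₆, false_and, and_false, if_false] at h₄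
    omega
  have hs : w s = u s ∧ w t = u t ∨ w s = u t ∧ w t = u s := by
    have h₁ := htwo (u s)
    have h₂ := htwo (u s + 1)
    have h₃ := htwo (u t)
    have h₄ := htwo (u t + 1)
    grind
  refine hs.imp (fun h => ?_) (fun h => ?_) <;> funext j
  · grind
  · simp only [Swap]
    grind

theorem exists_between_up {n m : ℕ} {u : Fin n → ℕ} {s j : Fin n} (hs : u s ≤ m - 1)
    (hsj : s < j) (hj : u j = u s ∨ u j = u s + 1) :
    ∃ w, USStep m u w ∧ USLt m w (Up u s) ∧ w ≠ Up u s := by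
  rcases hj with hj | hj
  · have e : Up u s = Swap (Up u j) s j := by
      funext i
      simp only [Up, Swap]
      grind
    have h : USStep m (Up u j) (Up u s) :=
      Or.inr ⟨s, j, hsj, by simp [Up, hsj.ne, hj], e⟩
    exact ⟨Up u j, Or.inl ⟨j, hj ▸ hs, rfl⟩, .single h, h.ne.symm⟩
  · have e : Up u s = Up (Swap u s j) j := by
      funext i
      simp only [Up, Swap]
      grind
    have h : USStep m (Swap u s j) (Up u s) :=
      Or.inl ⟨j, by simpa [Swap, hsj.ne'] using hs, e⟩
    exact ⟨Swap u s j, Or.inr ⟨s, j, hsj, by omega, rfl⟩, .single h, h.ne.symm⟩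

theorem exists_between_swap {n m : ℕ} {u : Fin n → ℕ} {s j t : Fin n} (hu : u s < u t)
    (hsj : s < j) (hjt : j < t) (h₁ : u s ≤ u j) (h₂ : u j ≤ u t) :
    ∃ w, USStep m u w ∧ USLt m w (Swap u s t) ∧ w ≠ Swap u s t := by
  have hst := hsj.trans hjt
  rcases h₁.eq_or_lt with h₁ | h₁
  · have e : Swap u s t = Swap (Swap u j t) s j := by
      funext i
      simp only [Swap]
      grind
    have h : USStep m (Swap u j t) (Swap u s t) :=
      Or.inr ⟨s, j, hsj, by simp only [Swap]; grind, e⟩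
    exact ⟨Swap u j t, Or.inr ⟨j, t, hjt, by omega, rfl⟩, .single h, h.ne.symm⟩
  · refine ⟨Swap u s j, Or.inr ⟨s, j, hsj, h₁, rfl⟩, ?_⟩
    have hx : USStep m (Swap u s j) (Swap (Swap u s j) j t) :=
      Or.inr ⟨j, t, hjt, by simp only [Swap]; grind, rfl⟩
    rcases h₂.eq_or_lt with h₂ | h₂
    · have e : Swap u s t = Swap (Swap u s j) j t := by
        funext i
        simp only [Swap]
        grind
      rw [e]
      exact ⟨.single hx, hx.ne.symm⟩
    · have e : Swap u s t = Swap (Swap (Swap u s j) j t) s j := by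
        funext i
        simp only [Swap]
        grind
      have hy : USStep m (Swap (Swap u s j) j t) (Swap u s t) :=
        Or.inr ⟨s, j, hsj, by simp only [Swap]; grind, e⟩
      refine ⟨.tail (.single hx) hy, fun h => ?_⟩
      have := congrFun h s
      simp only [Swap, if_true] at this
      omega

theorem USLt.exists_step {n m : ℕ} {u v : Fin n → ℕ} (h : USLt m u v) :
    ∃ x, USStep m u x ∧ USLe m x v := by
  obtain ⟨x, hx, hxv⟩ := Relation.TransGen.head'_iff.1 h
  rcases Relation.reflTransGen_iff_eq_or_transGen.1 hxv with rfl | h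
  · exact ⟨_, hx, Or.inr rfl⟩
  · exact ⟨x, hx, Or.inl h⟩

theorem stmt_8 (n m : ℕ) (hn : 0 < n) (hm : 0 < m)
    (u v : Fin n → ℕ) (hu : InGamma m u) (hv : InGamma m v) :
    (USLt m u v ∧
      ∀ w : Fin n → ℕ, InGamma m w → USLe m u w → USLe m w v → (w = u ∨ w = v)) ↔
    ((∃ s : Fin n, u s ≤ m - 1 ∧ v = Up u s ∧
        ∀ j : Fin n, s < j → u j ≠ u s ∧ u j ≠ u s + 1) ∨
     (∃ s t : Fin n, s < t ∧ u s < u t ∧ v = Swap u s t ∧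
        ∀ j : Fin n, s < j → j < t → ¬(u s ≤ u j ∧ u j ≤ u t))) := by
  constructor
  · rintro ⟨hlt, hcov⟩
    have hno : ∀ w, USStep m u w → USLt m w v → w ≠ v → False := fun w huw hwv hne =>
      (hcov w (huw.inGamma hm hu) (Or.inl (.single huw)) (Or.inl hwv)).elim huw.ne hne
    obtain ⟨x, hux, hxv⟩ := hlt.exists_step
    obtain rfl : x = v :=
      (hcov x (hux.inGamma hm hu) (Or.inl (.single hux)) hxv).resolve_left hux.ne
    rcases hux with ⟨s, hs, rfl⟩ | ⟨s, t, hst, hut, rfl⟩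
    · refine Or.inl ⟨s, hs, rfl, fun j hsj => ?_⟩
      by_contra hj
      obtain ⟨w, huw, hwv, hne⟩ := exists_between_up hs hsj (by omega)
      exact hno w huw hwv hne
    · refine Or.inr ⟨s, t, hst, hut, rfl, fun j hsj hjt hj => ?_⟩
      obtain ⟨w, huw, hwv, hne⟩ := exists_between_swap (m := m) hut hsj hjt hj.1 hj.2
      exact hno w huw hwv hne
  · rintro (⟨s, hs, rfl, hj⟩ | ⟨s, t, hst, hut, rfl, hj⟩)
    · exact ⟨.single (Or.inl ⟨s, hs, rfl⟩), fun w _ => eq_or_eq_of_between_up hj⟩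
    · exact ⟨.single (Or.inr ⟨s, t, hst, hut, rfl⟩),
        fun w _ => eq_or_eq_of_between_swap hst hut hj⟩
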